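/- arXiv:1706.08185 — 3 statements merged into one kernel-verified Lean document; each statement's English description precedes it below -/
import Mathlib

section
/- Fix real parameters α, β. A point x = (q1,q2,p1,p2) ∈ ℝ⁴ satisfies G_{α,β}(x) = 0 if and only if there exists q0 ∈ ℝ with x = (q0, 0, 0, −(3/4)β q0) and (1/2)q0² − (9/16)β² q0 + α = 0. Moreover, at any such point the characteristic polynomial of the Jacobian matrix of G_{α,β} equals X⁴ + (5/2)β X² + ((9/16)β² − q0); in particular the eigenvalues λ satisfy λ² = −(5/4)β ± √(β² + q0) when β² + q0 ≥ 0. -/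
open Polynomial Matrix

noncomputable section

/-- The vector field of the reduced truncated Hamiltonian
H_t = (1/2)p2² − p1 q2 + α q1 + β((1/2)q2² + (3/4)p2 q1) + (1/6)q1³,
in coordinates (q1,q2,p1,p2) = (v 0, v 1, v 2, v 3). -/
def Gvf (α β : ℝ) (v : Fin 4 → ℝ) : Fin 4 → ℝ :=
  ![ -v 1,
     v 3 + (3/4)*β*(v 0),
     -α - (3/4)*β*(v 3) - (1/2)*(v 0)^2,
     v 2 - β*(v 1) ]

/-- The Jacobian matrix of a vector field G : ℝ⁴ → ℝ⁴ at a point x. -/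
def jacobian (G : (Fin 4 → ℝ) → (Fin 4 → ℝ)) (x : Fin 4 → ℝ) :
    Matrix (Fin 4) (Fin 4) ℝ :=
  Matrix.of fun i j => fderiv ℝ (fun y => G y i) x (Pi.single j 1)

theorem jac_eq (α β : ℝ) (x : Fin 4 → ℝ) :
    jacobian (Gvf α β) x = !![0, -1, 0, 0; (3/4)*β, 0, 0, 1; -x 0, 0, 0, -(3/4)*β; 0, -β, 1, 0] := by
  have h : ∀ k : Fin 4, HasFDerivAt (fun y : Fin 4 → ℝ => y k)
      (ContinuousLinearMap.proj (R := ℝ) (φ := fun _ : Fin 4 => ℝ) k) x :=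
    fun k => hasFDerivAt_apply k x
  have h0 := (h 1).fun_neg
  have h1 := (h 3).fun_add ((h 0).const_mul ((3/4)*β))
  have h2 := (((h 3).const_mul ((3/4)*β)).const_sub (-α)).fun_sub ((HasFDerivAt.pow (h 0) 2).const_mul (1/2))
  have h3 := (h 2).fun_sub ((h 1).const_mul β)
  ext i j
  fin_cases i
  · change fderiv ℝ (fun y : Fin 4 → ℝ => -y 1) x (Pi.single j 1) = _
    rw [h0.fderiv]
    fin_cases j <;> simp
  · change fderiv ℝ (fun y : Fin 4 → ℝ => y 3 + (3/4)*β*(y 0)) x (Pi.single j 1) = _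
    rw [h1.fderiv]
    fin_cases j <;> simp
  · change fderiv ℝ (fun y : Fin 4 → ℝ => -α - (3/4)*β*(y 3) - (1/2)*(y 0)^2) x (Pi.single j 1) = _
    rw [h2.fderiv]
    fin_cases j <;> simp
  · change fderiv ℝ (fun y : Fin 4 → ℝ => y 2 - β*(y 1)) x (Pi.single j 1) = _
    rw [h3.fderiv]
    fin_cases j <;> simp

theorem charpoly_jac (α β q0 : ℝ) :
    (jacobian (Gvf α β) ![q0, 0, 0, -(3/4)*β*q0]).charpoly =
        X^4 + C ((5/2)*β) * X^2 + C ((9/16)*β^2 - q0) := by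
  rw [jac_eq]
  apply Polynomial.funext
  intro t
  rw [Matrix.eval_charpoly]
  simp [Matrix.det_succ_row_zero, Fin.sum_univ_succ, Fin.succAbove, Matrix.scalar_apply]
  ring

theorem stmt_14 (α β : ℝ) :
    (∀ x : Fin 4 → ℝ, Gvf α β x = 0 ↔
      ∃ q0 : ℝ, x = ![q0, 0, 0, -(3/4)*β*q0] ∧
        (1/2)*q0^2 - (9/16)*β^2*q0 + α = 0) ∧
    (∀ q0 : ℝ, (1/2)*q0^2 - (9/16)*β^2*q0 + α = 0 →
      (jacobian (Gvf α β) ![q0, 0, 0, -(3/4)*β*q0]).charpoly =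
        X^4 + C ((5/2)*β) * X^2 + C ((9/16)*β^2 - q0) ∧
      ∀ lam : ℂ,
        (((jacobian (Gvf α β) ![q0, 0, 0, -(3/4)*β*q0]).map
            (fun r => (r : ℂ))).charpoly).IsRoot lam →
        0 ≤ β^2 + q0 →
        lam^2 = -(5/4)*(β : ℂ) + (Real.sqrt (β^2 + q0) : ℝ) ∨
        lam^2 = -(5/4)*(β : ℂ) - (Real.sqrt (β^2 + q0) : ℝ)) := by
  refine ⟨?_, ?_⟩
  · intro x
    constructor
    · intro h
      have e0 := congrFun h 0
      have e1 := congrFun h 1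
      have e2 := congrFun h 2
      have e3 := congrFun h 3
      simp [Gvf] at e0 e1 e2 e3
      have e4 : x 3 = -(3/4)*β*x 0 := by linarith
      rw [e0] at e3
      refine ⟨x 0, ?_, ?_⟩
      · ext i
        fin_cases i
        · simp
        · simpa using e0
        · simpa using e3
        · simpa using e4
      · rw [e4] at e2
        linarith
    · rintro ⟨q0, rfl, h⟩
      ext i
      fin_cases i
      · simp [Gvf]
      · simp [Gvf]
      · simp [Gvf]
        linarith
      · simp [Gvf]
  · intro q0 _
    refine ⟨charpoly_jac α β q0, ?_⟩
    intro lam hl hn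
    have hm := Matrix.charpoly_map (jacobian (Gvf α β) ![q0, 0, 0, -(3/4)*β*q0]) Complex.ofRealHom
    change (Matrix.map _ (fun r : ℝ => (r : ℂ))).charpoly = _ at hm
    rw [hm, charpoly_jac] at hl
    simp [Polynomial.IsRoot] at hl
    have hs : ((Real.sqrt (β^2 + q0) : ℝ) : ℂ)^2 = (β:ℂ)^2 + q0 := by
      rw [← Complex.ofReal_pow, Real.sq_sqrt hn]
      push_cast
      rfl
    have hf : (lam^2 - (-(5/4)*(β : ℂ) + (Real.sqrt (β^2 + q0) : ℝ))) *
        (lam^2 - (-(5/4)*(β : ℂ) - (Real.sqrt (β^2 + q0) : ℝ))) = 0 := by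
      linear_combination hl - hs
    rcases mul_eq_zero.mp hf with h | h
    · exact Or.inl (sub_eq_zero.mp h)
    · exact Or.inr (sub_eq_zero.mp h)
end
end

section
/- Fix β ∈ ℝ and set q0 = (9/16)β² and α = (81/512)β⁴ (equivalently, 512α = 81β⁴). Then the point x = (q0, 0, 0, −(3/4)β q0) satisfies G_{α,β}(x) = 0, and the characteristic polynomial of the Jacobian matrix of G_{α,β} at x equals X²(X² + (5/2)β). In particular 0 is an eigenvalue of algebraic multiplicity two; this is the fold curve of the reduced system. -/
open Polynomial Matrix

noncomputable section

theorem jac_eq_aux (α β : ℝ) (x : Fin 4 → ℝ) :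
    jacobian (Gvf α β) x =
      !![0, -1, 0, 0; (3/4)*β, 0, 0, 1; -(x 0), 0, 0, -((3/4)*β); 0, -β, 1, 0] := by
  have hp : ∀ k : Fin 4, HasFDerivAt (fun y : Fin 4 → ℝ => y k)
      (ContinuousLinearMap.proj (R := ℝ) (φ := fun _ : Fin 4 => ℝ) k) x :=
    fun k => hasFDerivAt_apply k x
  have h0 := (hp 1).neg
  have h1 := (hp 3).add ((hp 0).const_mul ((3/4)*β))
  have h2 := (((hp 3).const_mul ((3/4)*β)).const_sub (-α)).sub (((hp 0).pow 2).const_mul (1/2))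
  have h3 := (hp 2).sub ((hp 1).const_mul β)
  have e0 : fderiv ℝ (fun y => Gvf α β y 0) x = _ := h0.fderiv
  have e1 : fderiv ℝ (fun y => Gvf α β y 1) x = _ := h1.fderiv
  have e2 : fderiv ℝ (fun y => Gvf α β y 2) x = _ := h2.fderiv
  have e3 : fderiv ℝ (fun y => Gvf α β y 3) x = _ := h3.fderiv
  ext i j
  simp only [jacobian, Matrix.of_apply]
  fin_cases i
  · simp only [Fin.zero_eta, e0]
    fin_cases j <;> simp [Pi.single_apply]
  · simp only [Fin.mk_one, e1]
    fin_cases j <;> simp [Pi.single_apply]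
  · simp only [Fin.reduceFinMk, e2]
    fin_cases j <;> simp [Pi.single_apply]
  · simp only [Fin.reduceFinMk, e3]
    fin_cases j <;> simp [Pi.single_apply]

theorem stmt_15 (β : ℝ) (q0 α : ℝ) (hq0 : q0 = (9/16)*β^2) (hα : α = (81/512)*β^4) :
    Gvf α β ![q0, 0, 0, -(3/4)*β*q0] = 0 ∧
    (jacobian (Gvf α β) ![q0, 0, 0, -(3/4)*β*q0]).charpoly =
      X^2 * (X^2 + C ((5/2)*β)) := by
  constructor
  · subst hq0 hα
    ext i
    fin_cases i <;> simp [Gvf] <;> ring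
  · rw [jac_eq_aux]
    have hX : (C q0 : ℝ[X]) = C (9/16) * C β ^ 2 := by
      rw [hq0]; simp
    have h1 : (C (3/4 * β) : ℝ[X]) = C (3/4) * C β := by simp
    have h2 : (C (5/2 * β) : ℝ[X]) = (C (3/4) + C (3/4) + 1) * C β := by
      rw [← C_1, ← C_add, ← C_add, ← C_mul]; norm_num
    have h3 : (C (9/16) : ℝ[X]) = C (3/4) * C (3/4) := by
      rw [← C_mul]; norm_num
    rw [h2]
    simp only [Matrix.charpoly, Matrix.charmatrix, Matrix.det_succ_row_zero, Fin.sum_univ_succ]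
    simp [Fin.succAbove, Matrix.submatrix, Matrix.det_fin_three, -map_mul, -C_mul, hX, h1, h3]
    ring
end
end

section
/- Fix β ∈ ℝ and set q0 = −β² and α = −(17/16)β⁴ (equivalently, 16α = −17β⁴). Then the point x = (q0, 0, 0, −(3/4)β q0) satisfies G_{α,β}(x) = 0, and the characteristic polynomial of the Jacobian matrix of G_{α,β} at x equals (X² + (5/4)β)². In particular every eigenvalue is double; this is the Hopf curve of the reduced system, on which the Hamiltonian-Hopf bifurcation occurs. -/
open Polynomial Matrix

noncomputable section

theorem jac_aux (α β : ℝ) (x : Fin 4 → ℝ) : jacobian (Gvf α β) x =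
    !![0, -1, 0, 0; (3/4)*β, 0, 0, 1; -x 0, 0, 0, -((3/4)*β); 0, -β, 1, 0] := by
  have p : ∀ k : Fin 4, HasFDerivAt (fun y : Fin 4 → ℝ => y k)
      (ContinuousLinearMap.proj (R := ℝ) (φ := fun _ : Fin 4 => ℝ) k) x :=
    fun k => hasFDerivAt_apply k x
  have h0 : HasFDerivAt (fun y => Gvf α β y 0) _ x := (p 1).neg
  have h1 : HasFDerivAt (fun y => Gvf α β y 1) _ x := (p 3).add ((p 0).const_mul ((3/4)*β))
  have h2 : HasFDerivAt (fun y => Gvf α β y 2) _ x :=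
    (((p 3).const_mul ((3/4)*β)).const_sub (-α)).sub (((p 0).pow 2).const_mul (1/2))
  have h3 : HasFDerivAt (fun y => Gvf α β y 3) _ x := (p 2).sub ((p 1).const_mul β)
  ext i j
  fin_cases i
  · change fderiv ℝ (fun y => Gvf α β y 0) x (Pi.single j 1) = _
    rw [h0.fderiv]
    fin_cases j <;> simp [Pi.single_apply]
  · change fderiv ℝ (fun y => Gvf α β y 1) x (Pi.single j 1) = _
    rw [h1.fderiv]
    fin_cases j <;> simp [Pi.single_apply]
  · change fderiv ℝ (fun y => Gvf α β y 2) x (Pi.single j 1) = _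
    rw [h2.fderiv]
    fin_cases j <;> simp [Pi.single_apply]
  · change fderiv ℝ (fun y => Gvf α β y 3) x (Pi.single j 1) = _
    rw [h3.fderiv]
    fin_cases j <;> simp [Pi.single_apply]

theorem stmt_16 (β : ℝ) (q0 α : ℝ) (hq0 : q0 = -β^2) (hα : α = -(17/16)*β^4) :
    Gvf α β ![q0, 0, 0, -(3/4)*β*q0] = 0 ∧
    (jacobian (Gvf α β) ![q0, 0, 0, -(3/4)*β*q0]).charpoly =
      (X^2 + C ((5/4)*β))^2 := by
  subst hq0 hα
  constructor
  · ext i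
    fin_cases i <;> simp [Gvf] <;> ring
  · rw [jac_aux]
    have e : (C ((5/4)*β) : ℝ[X]) = 5 * C (β/4) := by
      rw [show (5/4)*β = 5 * (β/4) by ring, C_mul]; rfl
    have e1 : (C ((3/4)*β) : ℝ[X]) = 3 * C (β/4) := by
      rw [show (3/4)*β = 3 * (β/4) by ring, C_mul]; rfl
    have e2 : (C β : ℝ[X]) = 4 * C (β/4) := by
      conv_lhs => rw [show β = 4 * (β/4) by ring, C_mul]
      rfl
    rw [e, Matrix.charpoly, Matrix.det_succ_row_zero]
    simp [Fin.sum_univ_succ, Matrix.det_fin_three, Matrix.charmatrix_apply, Fin.succAbove,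
      -map_mul, -map_div₀, -C_mul, e1, Matrix.diagonal]
    simp only [e2]
    ring
end
end
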